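/- arXiv:1407.6785 — 5 statements merged into one kernel-verified Lean document; each statement's English description precedes it below -/
import Mathlib

section
/- Let θ ≥ 0 and q > 0, and let W_θ, W_r : ℝ → ℝ vanish on (−∞,0), be continuous on [0,∞), and satisfy q·∫_0^s W_θ(s−z)·W_r(z) dz = W_r(s) − W_θ(s) for all s ≥ 0. Then for all x ≥ 0 and all y ≥ −x, the function g(θ,q,x,y) := W_r(x+y) − q·∫_0^x W_θ(x−z)·W_r(z+y) dz satisfies g(θ,q,x,y) = W_θ(x+y) + q·∫_0^y W_θ(x+y−z)·W_r(z) dz, where for y < 0 the integral ∫_0^y is the signed integral −∫_y^0 (which vanishes since W_r = 0 on (−∞,0)); in particular g(θ,q,x,y) = W_θ(x+y) for y ∈ [−x,0]. -/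
open MeasureTheory Set

/-- Equivalence of the two expressions (Eq. (7) and Eq. (9)) for the auxiliary
function `g(θ,q,x,y)` built from the scale functions `W_θ = W^{(θ)}` and
`W_r = W^{(θ+q)}`. -/
theorem g_two_forms (θ q : ℝ) (hθ : 0 ≤ θ) (hq : 0 < q)
    (Wθ Wr : ℝ → ℝ)
    (hWθ0 : ∀ z < (0 : ℝ), Wθ z = 0) (hWr0 : ∀ z < (0 : ℝ), Wr z = 0)
    (hWθc : ContinuousOn Wθ (Ici 0)) (hWrc : ContinuousOn Wr (Ici 0))
    (hconv : ∀ s ≥ (0 : ℝ),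
      q * ∫ z in (0 : ℝ)..s, Wθ (s - z) * Wr z = Wr s - Wθ s) :
    ∀ x ≥ (0 : ℝ), ∀ y ≥ -x,
      (Wr (x + y) - q * ∫ z in (0 : ℝ)..x, Wθ (x - z) * Wr (z + y)
        = Wθ (x + y) + q * ∫ z in (0 : ℝ)..y, Wθ (x + y - z) * Wr z) ∧
      (y ≤ 0 →
        Wr (x + y) - q * ∫ z in (0 : ℝ)..x, Wθ (x - z) * Wr (z + y)
          = Wθ (x + y)) := by
  intro x hx y hy
  have hs : 0 ≤ x + y := by linarith
  have hshift : ∫ z in (0 : ℝ)..x, Wθ (x - z) * Wr (z + y)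
      = ∫ z in y..(x + y), Wθ (x + y - z) * Wr z := by
    have h := intervalIntegral.integral_comp_add_right (a := 0) (b := x)
      (fun z => Wθ (x + y - z) * Wr z) y
    simpa only [add_sub_add_right_eq_sub, zero_add] using h
  have hint : IntervalIntegrable (fun z => Wθ (x + y - z) * Wr z) volume 0 (x + y) := by
    apply ContinuousOn.intervalIntegrable
    rw [uIcc_of_le hs]
    refine ContinuousOn.mul (hWθc.comp (by fun_prop) fun z hz => ?_)
      (hWrc.mono fun z hz => hz.1)
    exact sub_nonneg.2 hz.2
  have hzero : y ≤ 0 → EqOn (fun _ => 0) (fun z => Wθ (x + y - z) * Wr z) (uIoo y 0) := by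
    intro hy0 z hz
    rw [uIoo_of_le hy0] at hz
    simp [hWr0 z hz.2]
  have hint' : IntervalIntegrable (fun z => Wθ (x + y - z) * Wr z) volume 0 y := by
    rcases le_total y 0 with hy0 | hy0
    · exact (intervalIntegrable_const.congr_uIoo (hzero hy0)).symm
    · refine hint.mono_set ?_
      rw [uIcc_of_le hy0, uIcc_of_le hs]
      exact Icc_subset_Icc_right (by linarith)
  have hmain : Wr (x + y) - q * ∫ z in (0 : ℝ)..x, Wθ (x - z) * Wr (z + y)
      = Wθ (x + y) + q * ∫ z in (0 : ℝ)..y, Wθ (x + y - z) * Wr z := by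
    rw [hshift, ← intervalIntegral.integral_interval_sub_left hint hint', mul_sub,
      hconv (x + y) hs]
    ring
  refine ⟨hmain, fun hy0 => ?_⟩
  have hvanish : ∫ z in (0 : ℝ)..y, Wθ (x + y - z) * Wr z = 0 := by
    rw [intervalIntegral.integral_symm, ← intervalIntegral.integral_congr_uIoo (hzero hy0)]
    simp
  rw [hmain, hvanish, mul_zero, add_zero]
end

section
/- Let W : [0,∞) → (0,∞) be differentiable with lim_{b→∞} W'(b)/W(b) = α for some α ≥ 0, let β > α and q > 0, and assume ∫_0^∞ e^{−β z} W(z) dz = 1/q. Then lim_{b→∞} W(b) / ( e^{β b} − q·∫_0^b W(b−z) e^{β z} dz ) = (β − α)/q. -/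
open MeasureTheory Set Real Filter

theorem hasDerivAt_exp_neg_mul_mul {W : ℝ → ℝ} {w b : ℝ} (γ : ℝ) (h : HasDerivAt W w b) :
    HasDerivAt (fun z => Real.exp (-γ * z) * W z) (Real.exp (-γ * b) * (w - γ * W b)) b := by
  have h1 : HasDerivAt (fun z : ℝ => Real.exp (-γ * z)) (Real.exp (-γ * b) * (-γ)) b := by
    simpa using ((hasDerivAt_id b).const_mul (-γ)).exp
  exact (h1.mul h).congr_deriv (by ring)

/-- A positive function whose logarithmic derivative tends to `α` grows slower than
`exp (β * b)` for every `β > α`. -/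
theorem tendsto_exp_neg_mul_mul_zero {α β : ℝ} (hβ : α < β) {W W' : ℝ → ℝ}
    (hWpos : ∀ᶠ b in atTop, 0 < W b) (hderiv : ∀ᶠ b in atTop, HasDerivAt W (W' b) b)
    (hlim : Tendsto (fun b => W' b / W b) atTop (nhds α)) :
    Tendsto (fun b => Real.exp (-β * b) * W b) atTop (nhds 0) := by
  obtain ⟨γ, hαγ, hγβ⟩ := exists_between hβ
  obtain ⟨B, hB⟩ := eventually_atTop.1
    (hWpos.and (hderiv.and (hlim.eventually (gt_mem_nhds hαγ))))
  have hanti : AntitoneOn (fun b => Real.exp (-γ * b) * W b) (Ici B) := by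
    have hd : ∀ b ∈ Ici B, HasDerivAt (fun z => Real.exp (-γ * z) * W z)
        (Real.exp (-γ * b) * (W' b - γ * W b)) b :=
      fun b hb => hasDerivAt_exp_neg_mul_mul γ (hB b hb).2.1
    refine antitoneOn_of_deriv_nonpos (convex_Ici B)
      (fun b hb => (hd b hb).continuousAt.continuousWithinAt)
      (fun b hb => (hd b (interior_subset hb)).differentiableAt.differentiableWithinAt)
      (fun b hb => ?_)
    have hb' := interior_subset hb
    rw [(hd b hb').deriv]
    obtain ⟨hpos, -, hlt⟩ := hB b hb'
    rw [div_lt_iff₀ hpos] at hlt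
    exact mul_nonpos_of_nonneg_of_nonpos (Real.exp_pos _).le (by linarith)
  have hexp : Tendsto (fun b => Real.exp (-(β - γ) * b) * (Real.exp (-γ * B) * W B)) atTop
      (nhds 0) := by
    have := Real.tendsto_exp_atBot.comp
      (tendsto_id.const_mul_atTop_of_neg (show -(β - γ) < 0 by linarith))
    simpa using this.mul_const (Real.exp (-γ * B) * W B)
  refine squeeze_zero' ?_ ?_ hexp
  · filter_upwards [hWpos] with b hb using by positivity
  · filter_upwards [eventually_ge_atTop B] with b hb
    have hle := hanti self_mem_Ici hb hb
    calc Real.exp (-β * b) * W b = Real.exp (-(β - γ) * b) * (Real.exp (-γ * b) * W b) := by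
          rw [← mul_assoc, ← Real.exp_add]; ring_nf
      _ ≤ _ := mul_le_mul_of_nonneg_left hle (Real.exp_pos _).le

theorem integral_comp_sub_mul_exp (W : ℝ → ℝ) (β b : ℝ) :
    ∫ z in (0 : ℝ)..b, W (b - z) * Real.exp (β * z) =
      Real.exp (β * b) * ∫ z in (0 : ℝ)..b, Real.exp (-β * z) * W z := by
  have h := intervalIntegral.integral_comp_sub_left (a := 0) (b := b)
    (fun z => Real.exp (-β * z) * W z) b
  rw [sub_self, sub_zero] at h
  rw [← h, ← intervalIntegral.integral_const_mul]
  congr 1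
  ext z
  rw [← mul_assoc, ← Real.exp_add, mul_comm]
  ring_nf

/-- Equation (13) of the paper: the limit
`lim_{b→∞} W(b) / (e^{βb} − q ∫_0^b W(b−z) e^{βz} dz) = (β − α)/q`. -/
theorem limit_denominator (α β q : ℝ) (hα : 0 ≤ α) (hβ : α < β) (hq : 0 < q)
    (W W' : ℝ → ℝ) (hWpos : ∀ b ≥ (0 : ℝ), 0 < W b)
    (hderiv : ∀ b ≥ (0 : ℝ), HasDerivWithinAt W (W' b) (Ici 0) b)
    (hlim : Tendsto (fun b => W' b / W b) atTop (nhds α))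
    (hint : IntegrableOn (fun z => Real.exp (-β * z) * W z) (Ioi 0))
    (hlap : ∫ z in Ioi (0 : ℝ), Real.exp (-β * z) * W z = 1 / q) :
    Tendsto
      (fun b =>
        W b / (Real.exp (β * b) - q * ∫ z in (0 : ℝ)..b, W (b - z) * Real.exp (β * z)))
      atTop (nhds ((β - α) / q)) := by
  have hW : ∀ b > (0 : ℝ), HasDerivAt W (W' b) b := fun b hb =>
    (hderiv b hb.le).hasDerivAt (Ici_mem_nhds hb)
  have hf : ∀ b > (0 : ℝ), HasDerivAt (fun z => Real.exp (-β * z) * W z)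
      (Real.exp (-β * b) * (W' b - β * W b)) b :=
    fun b hb => hasDerivAt_exp_neg_mul_mul β (hW b hb)
  have hcont : ContinuousOn (fun z => Real.exp (-β * z) * W z) (Ioi 0) :=
    fun b hb => (hf b hb).continuousAt.continuousWithinAt
  have hD : ∀ b > (0 : ℝ), HasDerivAt
      (fun b => 1 - q * ∫ z in (0 : ℝ)..b, Real.exp (-β * z) * W z)
      (-(q * (Real.exp (-β * b) * W b))) b := fun b hb =>
    ((intervalIntegral.integral_hasDerivAt_right
      ((intervalIntegrable_iff_integrableOn_Ioc_of_le hb.le).2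
        (hint.mono_set Ioc_subset_Ioi_self))
      (hcont.stronglyMeasurableAtFilter isOpen_Ioi b hb)
      (hf b hb).continuousAt).const_mul q).const_sub 1
  have hD0 : Tendsto (fun b => 1 - q * ∫ z in (0 : ℝ)..b, Real.exp (-β * z) * W z) atTop
      (nhds 0) := by
    have h := ((intervalIntegral_tendsto_integral_Ioi 0 hint tendsto_id).const_mul q).const_sub 1
    rwa [hlap, mul_one_div_cancel hq.ne', sub_self] at h
  have hf0 : Tendsto (fun b => Real.exp (-β * b) * W b) atTop (nhds 0) :=
    tendsto_exp_neg_mul_mul_zero hβ ((eventually_ge_atTop 0).mono hWpos)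
      ((eventually_gt_atTop 0).mono hW) hlim
  have hratio : Tendsto (fun b => Real.exp (-β * b) * (W' b - β * W b) /
      -(q * (Real.exp (-β * b) * W b))) atTop (nhds ((β - α) / q)) := by
    refine ((hlim.const_sub β).div_const q).congr' ?_
    filter_upwards [eventually_gt_atTop 0] with b hb
    have := (hWpos b hb.le).ne'
    field_simp
    ring
  have hquot := HasDerivAt.lhopital_zero_atTop ((eventually_gt_atTop 0).mono hf)
    ((eventually_gt_atTop 0).mono hD)
    ((eventually_gt_atTop 0).mono fun b hb => by
      have := hWpos b (le_of_lt hb)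
      exact neg_ne_zero.2 (by positivity)) hf0 hD0 hratio
  refine hquot.congr fun b => ?_
  rw [integral_comp_sub_mul_exp, ← mul_div_mul_left _ _ (Real.exp_pos (β * b)).ne',
    ← mul_assoc, ← Real.exp_add]
  congr 1
  · simp
  · ring
end

section
/- Let θ ≥ 0 and q > 0, and let W_θ, W_r : ℝ → ℝ vanish on (−∞,0), be continuous on [0,∞), and satisfy q·∫_0^s W_θ(s−z)·W_r(z) dz = W_r(s) − W_θ(s) for all s ≥ 0. Assume moreover that W_θ is nondecreasing and strictly positive on (0,∞), differentiable on (0,∞) with lim_{b→∞} W_θ'(b)/W_θ(b) = α for some α ≥ 0, that β > α, and that ∫_0^∞ e^{−β z} W_θ(z) dz = 1/q. Then for every y ≤ 0: lim_{b→∞} [ W_r(b−y) − q·∫_0^b W_θ(b−z)·W_r(z−y) dz ] / [ e^{β b} − q·∫_0^b W_θ(b−z) e^{β z} dz ] = ((β − α)/q)·( e^{−α y} + q·∫_0^{−y} e^{−α(y+z)} W_r(z) dz ). -/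
open MeasureTheory Set Real Filter

section LogDerivative

variable {W W' : ℝ → ℝ} {α : ℝ}

/-- If `W' / W → α` at infinity, then `log W` has increments close to those of `α * ·`. -/
lemma eventually_abs_log_sub_log_sub_le (hpos : ∀ b > (0 : ℝ), 0 < W b)
    (hderiv : ∀ b > (0 : ℝ), HasDerivAt W (W' b) b)
    (hlim : Tendsto (fun b => W' b / W b) atTop (nhds α)) {ε : ℝ} (hε : 0 < ε) :
    ∀ᶠ b in atTop, ∀ t ≥ (0 : ℝ), |log (W (b + t)) - log (W b) - α * t| ≤ ε * t := by
  obtain ⟨B, hB⟩ := eventually_atTop.1 (Metric.tendsto_nhds.1 hlim ε hε)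
  filter_upwards [eventually_ge_atTop B, eventually_gt_atTop 0] with b hb hb0 t ht
  have hmem : ∀ x ∈ Ici b, HasDerivWithinAt (fun x => log (W x) - α * x) (W' x / W x - α)
      (Ici b) x := fun x hx => by
    have hx0 : 0 < x := hb0.trans_le hx
    have h := ((hderiv x hx0).log (hpos x hx0).ne').fun_sub ((hasDerivAt_id' x).const_mul α)
    rw [mul_one] at h
    exact h.hasDerivWithinAt
  have hmvt := Convex.norm_image_sub_le_of_norm_hasDerivWithin_le (C := ε) hmem
    (fun x hx => (hB x (hb.trans hx)).le) (convex_Ici b) (mem_Ici.2 le_rfl)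
    (mem_Ici.2 (le_add_of_nonneg_right ht))
  simp only [add_sub_cancel_left, norm_eq_abs, abs_of_nonneg ht] at hmvt
  convert hmvt using 2
  ring

lemma tendsto_add_div_of_tendsto_deriv_div (hpos : ∀ b > (0 : ℝ), 0 < W b)
    (hderiv : ∀ b > (0 : ℝ), HasDerivAt W (W' b) b)
    (hlim : Tendsto (fun b => W' b / W b) atTop (nhds α)) {t : ℝ} (ht : 0 ≤ t) :
    Tendsto (fun b => W (b + t) / W b) atTop (nhds (exp (α * t))) := by
  have hlog : Tendsto (fun b => log (W (b + t)) - log (W b)) atTop (nhds (α * t)) := by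
    rw [Metric.tendsto_nhds]
    intro ε hε
    have hpos' : 0 < ε / (t + 1) := by positivity
    filter_upwards [eventually_abs_log_sub_log_sub_le hpos hderiv hlim hpos'] with b hb
    refine (hb t ht).trans_lt ?_
    rw [div_mul_eq_mul_div, div_lt_iff₀ (by positivity)]
    nlinarith
  refine ((continuous_exp.tendsto _).comp hlog).congr' ?_
  filter_upwards [eventually_gt_atTop 0] with b hb
  simp [exp_sub, exp_log (hpos b hb), exp_log (hpos (b + t) (by linarith))]

lemma eventually_add_div_le_exp (hpos : ∀ b > (0 : ℝ), 0 < W b)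
    (hderiv : ∀ b > (0 : ℝ), HasDerivAt W (W' b) b)
    (hlim : Tendsto (fun b => W' b / W b) atTop (nhds α)) {γ : ℝ} (hγ : α < γ) :
    ∀ᶠ b in atTop, ∀ t ≥ (0 : ℝ), W (b + t) / W b ≤ exp (γ * t) := by
  filter_upwards [eventually_abs_log_sub_log_sub_le hpos hderiv hlim (sub_pos.2 hγ),
    eventually_gt_atTop 0] with b hb hb0 t ht
  have hWt := hpos (b + t) (by linarith)
  rw [← log_le_iff_le_exp (div_pos hWt (hpos b hb0)), log_div hWt.ne' (hpos b hb0).ne']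
  linarith [(abs_le.1 (hb t ht)).2]

lemma tendsto_integral_Ioi_exp_mul_add_div (hpos : ∀ b > (0 : ℝ), 0 < W b)
    (hderiv : ∀ b > (0 : ℝ), HasDerivAt W (W' b) b)
    (hlim : Tendsto (fun b => W' b / W b) atTop (nhds α)) {β : ℝ} (hβ : α < β) :
    Tendsto (fun b => ∫ t in Ioi (0 : ℝ), exp (-β * t) * (W (b + t) / W b)) atTop
      (nhds (1 / (β - α))) := by
  obtain ⟨γ, hαγ, hγβ⟩ := exists_between hβ
  have hval : ∫ t in Ioi (0 : ℝ), exp (-β * t) * exp (α * t) = 1 / (β - α) := by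
    have hneg : α - β < 0 := by linarith
    calc _ = ∫ t in Ioi (0 : ℝ), exp ((α - β) * t) := by
          congr 1; ext t; rw [← exp_add]; congr 1; ring
      _ = _ := by
          rw [integral_exp_mul_Ioi hneg, mul_zero, exp_zero, ← neg_sub β α, neg_div_neg_eq]
  rw [← hval]
  refine tendsto_integral_filter_of_dominated_convergence (fun t => exp ((γ - β) * t)) ?_ ?_
    (integrableOn_exp_mul_Ioi (by linarith) 0) ?_
  · filter_upwards [eventually_gt_atTop 0] with b hb
    refine ContinuousOn.aestronglyMeasurable (fun t ht => ?_) measurableSet_Ioi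
    have hc : ContinuousAt W (b + t) := (hderiv _ (add_pos hb ht)).continuousAt
    have hc' : ContinuousAt (fun t => W (b + t)) t :=
      ContinuousAt.comp (f := fun t => b + t) hc (by fun_prop)
    exact (ContinuousAt.mul (by fun_prop) (hc'.div_const _)).continuousWithinAt
  · filter_upwards [eventually_add_div_le_exp hpos hderiv hlim hαγ, eventually_gt_atTop 0]
      with b hb hb0
    refine (ae_restrict_iff' measurableSet_Ioi).2 (ae_of_all _ fun t ht => ?_)
    have hWt := hpos (b + t) (add_pos hb0 ht)
    have hWb := hpos b hb0
    rw [norm_of_nonneg (by positivity), sub_mul, sub_eq_neg_add, exp_add, ← neg_mul]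
    gcongr
    exact hb t (le_of_lt ht)
  · refine (ae_restrict_iff' measurableSet_Ioi).2 (ae_of_all _ fun t ht => ?_)
    exact (tendsto_add_div_of_tendsto_deriv_div hpos hderiv hlim (le_of_lt ht)).const_mul _

lemma tendsto_intervalIntegral_add_div_mul (hpos : ∀ b > (0 : ℝ), 0 < W b)
    (hderiv : ∀ b > (0 : ℝ), HasDerivAt W (W' b) b)
    (hlim : Tendsto (fun b => W' b / W b) atTop (nhds α)) {g : ℝ → ℝ}
    {c : ℝ} (hc : 0 ≤ c) (hg : ContinuousOn g (Icc 0 c)) :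
    Tendsto (fun b => ∫ z in (0 : ℝ)..c, W (b + (c - z)) / W b * g z) atTop
      (nhds (∫ z in (0 : ℝ)..c, exp (α * (c - z)) * g z)) := by
  refine intervalIntegral.tendsto_integral_filter_of_dominated_convergence
    (fun z => exp ((α + 1) * (c - z)) * ‖g z‖) ?_ ?_ ?_ ?_
  · filter_upwards [eventually_gt_atTop 0] with b hb
    rw [uIoc_of_le hc]
    refine ContinuousOn.aestronglyMeasurable
      (ContinuousOn.mul (fun z hz => ?_) (hg.mono Ioc_subset_Icc_self)) measurableSet_Ioc
    have hW : ContinuousAt W (b + (c - z)) :=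
      (hderiv _ (by linarith [hz.2])).continuousAt
    have hW' : ContinuousAt (fun z => W (b + (c - z))) z :=
      ContinuousAt.comp (f := fun z => b + (c - z)) hW (by fun_prop)
    exact (hW'.div_const _).continuousWithinAt
  · filter_upwards [eventually_add_div_le_exp hpos hderiv hlim (lt_add_one α),
      eventually_gt_atTop 0] with b hb hb0
    refine ae_of_all _ fun z hz => ?_
    rw [uIoc_of_le hc] at hz
    have hcz : 0 ≤ c - z := by linarith [hz.2]
    have hWz := hpos (b + (c - z)) (by linarith)
    have hWb := hpos b hb0
    rw [norm_mul, norm_of_nonneg (by positivity)]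
    gcongr
    exact hb _ hcz
  · refine ContinuousOn.intervalIntegrable ?_
    rw [uIcc_of_le hc]
    exact ContinuousOn.mul (by fun_prop) hg.norm
  · refine ae_of_all _ fun z hz => ?_
    rw [uIoc_of_le hc] at hz
    exact (tendsto_add_div_of_tendsto_deriv_div hpos hderiv hlim (sub_nonneg.2 hz.2)).mul_const _

end LogDerivative

lemma integral_Ioi_comp_const_add (f : ℝ → ℝ) (b : ℝ) :
    ∫ t in Ioi (0 : ℝ), f (b + t) = ∫ u in Ioi b, f u := by
  have h := (measurePreserving_add_left volume b).setIntegral_preimage_emb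
    (measurableEmbedding_addLeft b) f (Ioi b)
  simpa using h

/-- When the Laplace transform of `W` at `β` is `1 / q`, the defect of the convolution of `W`
with `exp (β * ·)` is a tail of that transform. -/
lemma exp_sub_mul_convolution_exp_eq {W : ℝ → ℝ} {q β b : ℝ} (hq : q ≠ 0) (hb : 0 ≤ b)
    (hint : IntegrableOn (fun z => exp (-β * z) * W z) (Ioi 0))
    (hlap : ∫ z in Ioi (0 : ℝ), exp (-β * z) * W z = 1 / q) :
    exp (β * b) - q * ∫ z in (0 : ℝ)..b, W (b - z) * exp (β * z) =
      q * ∫ t in Ioi (0 : ℝ), exp (-β * t) * W (b + t) := by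
  have hconv : ∫ z in (0 : ℝ)..b, W (b - z) * exp (β * z) =
      exp (β * b) * ∫ u in (0 : ℝ)..b, exp (-β * u) * W u := by
    rw [← intervalIntegral.integral_const_mul]
    have h := intervalIntegral.integral_comp_sub_left (a := 0) (b := b)
      (fun u => exp (β * b) * (exp (-β * u) * W u)) b
    rw [sub_self, sub_zero] at h
    rw [← h]
    congr 1
    ext z
    rw [← mul_assoc, ← exp_add, mul_comm]
    congr 2
    ring
  have htail : ∫ t in Ioi (0 : ℝ), exp (-β * t) * W (b + t) =
      exp (β * b) * ∫ u in Ioi b, exp (-β * u) * W u := by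
    rw [← integral_const_mul,
      ← integral_Ioi_comp_const_add (fun u => exp (β * b) * (exp (-β * u) * W u))]
    congr 1
    ext t
    rw [← mul_assoc, ← exp_add]
    congr 2
    ring
  have hsplit := intervalIntegral.integral_Ioi_sub_Ioi hint hb
  rw [hlap] at hsplit
  rw [hconv, htail, ← hsplit]
  field_simp
  ring

/-- Splitting the resolvent identity at `c` leaves only the part of the convolution over
`[0, c]`. -/
lemma resolvent_sub_mul_convolution_eq {W R : ℝ → ℝ} {q b c : ℝ} (hb : 0 ≤ b) (hc : 0 ≤ c)
    (hW : ContinuousOn W (Ici 0)) (hR : ContinuousOn R (Ici 0))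
    (hconv : q * ∫ z in (0 : ℝ)..(b + c), W (b + c - z) * R z = R (b + c) - W (b + c)) :
    R (b + c) - q * ∫ z in (0 : ℝ)..b, W (b - z) * R (z + c) =
      W (b + c) + q * ∫ z in (0 : ℝ)..c, W (b + (c - z)) * R z := by
  have hcont : ContinuousOn (fun z => W (b + c - z) * R z) (Icc 0 (b + c)) :=
    (hW.comp (by fun_prop) fun z hz => sub_nonneg.2 hz.2).mul (hR.mono Icc_subset_Ici_self)
  have hsplit := intervalIntegral.integral_add_adjacent_intervals
    (ContinuousOn.intervalIntegrable (μ := volume) (a := 0) (b := c) <| hcont.mono <| by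
      rw [uIcc_of_le hc]; exact Icc_subset_Icc_right (by linarith))
    (ContinuousOn.intervalIntegrable (μ := volume) (a := c) (b := b + c) <| hcont.mono <| by
      rw [uIcc_of_le (by linarith)]; exact Icc_subset_Icc_left hc)
  have hshift := intervalIntegral.integral_comp_add_right (a := 0) (b := b)
    (fun z => W (b + c - z) * R z) c
  simp only [add_sub_add_right_eq_sub, zero_add] at hshift
  simp only [← add_sub_assoc]
  rw [← hsplit, ← hshift] at hconv
  linarith

/-- Equation (14) of the paper: for `y ≤ 0`,
`lim_{b→∞} [W_r(b−y) − q∫_0^b W_θ(b−z)W_r(z−y)dz] / [e^{βb} − q∫_0^b W_θ(b−z)e^{βz}dz]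
 = ((β−α)/q)(e^{−αy} + q∫_0^{−y} e^{−α(y+z)}W_r(z)dz)`. -/
theorem limit_ratio_gerber_shiu (θ q α β : ℝ) (hθ : 0 ≤ θ) (hq : 0 < q)
    (hα : 0 ≤ α) (hβ : α < β)
    (Wθ Wr Wθ' : ℝ → ℝ)
    (hWθ0 : ∀ z < (0 : ℝ), Wθ z = 0) (hWr0 : ∀ z < (0 : ℝ), Wr z = 0)
    (hWθc : ContinuousOn Wθ (Ici 0)) (hWrc : ContinuousOn Wr (Ici 0))
    (hconv : ∀ s ≥ (0 : ℝ),
      q * ∫ z in (0 : ℝ)..s, Wθ (s - z) * Wr z = Wr s - Wθ s)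
    (hmono : MonotoneOn Wθ (Ioi 0)) (hpos : ∀ b > (0 : ℝ), 0 < Wθ b)
    (hderiv : ∀ b > (0 : ℝ), HasDerivAt Wθ (Wθ' b) b)
    (hlim : Tendsto (fun b => Wθ' b / Wθ b) atTop (nhds α))
    (hint : IntegrableOn (fun z => Real.exp (-β * z) * Wθ z) (Ioi 0))
    (hlap : ∫ z in Ioi (0 : ℝ), Real.exp (-β * z) * Wθ z = 1 / q) :
    ∀ y ≤ (0 : ℝ),
      Tendsto
        (fun b =>
          (Wr (b - y) - q * ∫ z in (0 : ℝ)..b, Wθ (b - z) * Wr (z - y)) /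
            (Real.exp (β * b) - q * ∫ z in (0 : ℝ)..b, Wθ (b - z) * Real.exp (β * z)))
        atTop
        (nhds (((β - α) / q) *
          (Real.exp (-α * y) + q * ∫ z in (0 : ℝ)..(-y), Real.exp (-α * (y + z)) * Wr z))) := by
  intro y hy
  obtain ⟨c, rfl⟩ : ∃ c, y = -c := ⟨-y, (neg_neg y).symm⟩
  have hc : 0 ≤ c := neg_nonpos.1 hy
  have hnum : Tendsto (fun b => Wθ (b + c) / Wθ b +
      q * ∫ z in (0 : ℝ)..c, Wθ (b + (c - z)) / Wθ b * Wr z) atTop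
      (nhds (exp (α * c) + q * ∫ z in (0 : ℝ)..c, exp (α * (c - z)) * Wr z)) :=
    (tendsto_add_div_of_tendsto_deriv_div hpos hderiv hlim hc).add
      ((tendsto_intervalIntegral_add_div_mul hpos hderiv hlim hc
        (hWrc.mono Icc_subset_Ici_self)).const_mul q)
  have hden := (tendsto_integral_Ioi_exp_mul_add_div hpos hderiv hlim hβ).const_mul q
  have hβα : 0 < β - α := sub_pos.2 hβ
  have hdiv := hnum.div hden (by positivity)
  have hexp : ∀ z, -α * (-c + z) = α * (c - z) := fun z => by ring
  simp only [hexp, neg_neg, neg_mul_neg, sub_neg_eq_add]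
  have hval : (β - α) / q * (exp (α * c) + q * ∫ z in (0 : ℝ)..c, exp (α * (c - z)) * Wr z) =
      (exp (α * c) + q * ∫ z in (0 : ℝ)..c, exp (α * (c - z)) * Wr z) /
        (q * (1 / (β - α))) := by
    field_simp
  rw [hval]
  refine hdiv.congr' ?_
  filter_upwards [eventually_gt_atTop 0] with b hb
  have hWb := (hpos b hb).ne'
  rw [exp_sub_mul_convolution_exp_eq hq.ne' hb.le hint hlap,
    resolvent_sub_mul_convolution_eq hb.le hc hWθc hWrc (hconv (b + c) (by linarith))]
  simp only [Pi.div_apply, div_mul_eq_mul_div, ← mul_div_assoc, integral_div,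
    intervalIntegral.integral_div]
  rw [← add_div, div_div_div_cancel_right₀ hWb]
end

section
/- Let θ ≥ 0 and q > 0, and let W_θ, W_r : ℝ → ℝ vanish on (−∞,0), be continuous on [0,∞), and satisfy q·∫_0^s W_θ(s−z)·W_r(z) dz = W_r(s) − W_θ(s) for all s ≥ 0. Assume moreover that W_θ is nondecreasing and strictly positive on (0,∞) and that lim_{b→∞} W_θ(b+s)/W_θ(b) = e^{α s} for every s ∈ ℝ, for some α ≥ 0. Then for every y ≥ 0, with g(θ,q,b,y) := W_r(b+y) − q·∫_0^b W_θ(b−z)·W_r(z+y) dz, one has lim_{b→∞} g(θ,q,b,y)/W_θ(b) = e^{α y}·(1 + q·∫_0^y e^{−α z} W_r(z) dz). -/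
open MeasureTheory Set Real Filter

/-- For `y ≥ 0`, `lim_{b→∞} g(θ,q,b,y)/W_θ(b) = e^{αy}(1 + q∫_0^y e^{−αz}W_r(z)dz)`,
where `g(θ,q,b,y) = W_r(b+y) − q∫_0^b W_θ(b−z)W_r(z+y)dz`; the limit is the
auxiliary function `𝓗^{(θ,q)}(y)` of the paper. -/
theorem g_over_Wtheta_tendsto (θ q α : ℝ) (hθ : 0 ≤ θ) (hq : 0 < q) (hα : 0 ≤ α)
    (Wθ Wr : ℝ → ℝ)
    (hWθ0 : ∀ z < (0 : ℝ), Wθ z = 0) (hWr0 : ∀ z < (0 : ℝ), Wr z = 0)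
    (hWθc : ContinuousOn Wθ (Ici 0)) (hWrc : ContinuousOn Wr (Ici 0))
    (hconv : ∀ s ≥ (0 : ℝ),
      q * ∫ z in (0 : ℝ)..s, Wθ (s - z) * Wr z = Wr s - Wθ s)
    (hmono : MonotoneOn Wθ (Ioi 0)) (hpos : ∀ b > (0 : ℝ), 0 < Wθ b)
    (hshift : ∀ s : ℝ,
      Tendsto (fun b => Wθ (b + s) / Wθ b) atTop (nhds (Real.exp (α * s)))) :
    ∀ y ≥ (0 : ℝ),
      Tendsto
        (fun b => (Wr (b + y) - q * ∫ z in (0 : ℝ)..b, Wθ (b - z) * Wr (z + y)) / Wθ b)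
        atTop
        (nhds (Real.exp (α * y) * (1 + q * ∫ z in (0 : ℝ)..y, Real.exp (-α * z) * Wr z))) := by
  intro y hy
  have hW (c y : ℝ) (hyc : y ≤ c) : ContinuousOn (fun u => Wθ (c - u)) (Icc 0 y) :=
    hWθc.comp (by fun_prop) fun u hu => by
      simp only [mem_Icc, mem_Ici] at hu ⊢
      linarith
  have hR (y : ℝ) : ContinuousOn Wr (Icc 0 y) := hWrc.mono Icc_subset_Ici_self
  have hnum : ∀ b > (0 : ℝ),
      Wr (b + y) - q * ∫ z in (0 : ℝ)..b, Wθ (b - z) * Wr (z + y) =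
        Wθ (b + y) + q * ∫ u in (0 : ℝ)..y, Wθ (b + y - u) * Wr u := by
    intro b hb
    have hsub : ∫ z in (0 : ℝ)..b, Wθ (b - z) * Wr (z + y) =
        ∫ u in y..(b + y), Wθ (b + y - u) * Wr u := by
      have h := intervalIntegral.integral_comp_add_right (a := 0) (b := b)
        (fun u => Wθ (b + y - u) * Wr u) y
      simpa only [add_sub_add_right_eq_sub, zero_add] using h
    have hcont : ContinuousOn (fun u => Wθ (b + y - u) * Wr u) (Icc 0 (b + y)) :=
      (hW (b + y) (b + y) le_rfl).mul (hR _)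
    have hsplit := intervalIntegral.integral_add_adjacent_intervals (μ := volume)
      (a := 0) (b := y) (c := b + y)
      ((hcont.mono (Icc_subset_Icc_right (by linarith))).intervalIntegrable_of_Icc hy)
      ((hcont.mono (Icc_subset_Icc_left hy)).intervalIntegrable_of_Icc (by linarith))
    have hc := hconv (b + y) (by linarith)
    rw [← hsplit] at hc
    rw [hsub]
    linarith
  have hint : Tendsto (fun b => ∫ u in (0 : ℝ)..y, Wθ (b + y - u) / Wθ b * Wr u) atTop
      (nhds (∫ u in (0 : ℝ)..y, Real.exp (α * (y - u)) * Wr u)) := by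
    refine intervalIntegral.tendsto_integral_filter_of_dominated_convergence
      (fun u => (Real.exp (α * y) + 1) * |Wr u|) ?_ ?_ ?_ ?_
    · filter_upwards [eventually_gt_atTop 0] with b hb
      refine ContinuousOn.aestronglyMeasurable ?_ measurableSet_uIoc
      rw [uIoc_of_le hy]
      exact (((hW (b + y) y (by linarith)).div_const _).mul (hR y)).mono Ioc_subset_Icc_self
    · filter_upwards [eventually_gt_atTop 0,
        (hshift y).eventually_lt_const (lt_add_one (Real.exp (α * y)))] with b hb hbound
      refine Eventually.of_forall fun u hu => ?_
      rw [uIoc_of_le hy] at hu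
      have hpos_u : 0 < b + y - u := by linarith [hu.2]
      have hle : Wθ (b + y - u) ≤ Wθ (b + y) :=
        hmono hpos_u (show 0 < b + y by linarith) (by linarith [hu.1])
      rw [norm_mul, Real.norm_eq_abs, Real.norm_eq_abs,
        abs_of_nonneg (div_nonneg (hpos _ hpos_u).le (hpos b hb).le)]
      gcongr
      exact (div_le_div_of_nonneg_right hle (hpos b hb).le).trans hbound.le
    · exact (((hR y).abs).const_mul _).intervalIntegrable_of_Icc hy
    · refine Eventually.of_forall fun u _ => ?_
      simpa only [add_sub_assoc] using (hshift (y - u)).mul_const (Wr u)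
  have hlim : Real.exp (α * y) * (1 + q * ∫ z in (0 : ℝ)..y, Real.exp (-α * z) * Wr z) =
      Real.exp (α * y) + q * ∫ u in (0 : ℝ)..y, Real.exp (α * (y - u)) * Wr u := by
    have hexp : ∀ u, Real.exp (α * (y - u)) * Wr u =
        Real.exp (α * y) * (Real.exp (-α * u) * Wr u) := fun u => by
      rw [← mul_assoc, ← Real.exp_add]
      ring_nf
    simp only [hexp, intervalIntegral.integral_const_mul]
    ring
  rw [hlim]
  refine ((hshift y).add (hint.const_mul q)).congr' ?_
  filter_upwards [eventually_gt_atTop 0] with b hb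
  rw [hnum b hb, add_div, mul_div_assoc, ← intervalIntegral.integral_div]
  simp only [div_mul_eq_mul_div]
end

section
/- Let θ ≥ 0 and q > 0, and let W_θ, W_r : ℝ → ℝ vanish on (−∞,0), be continuous on [0,∞), and satisfy q·∫_0^s W_θ(s−z)·W_r(z) dz = W_r(s) − W_θ(s) for all s ≥ 0. Assume moreover that W_r is nondecreasing and strictly positive on (0,∞) and that lim_{a→∞} W_r(a+s)/W_r(a) = e^{β s} for every s ∈ ℝ, for some β ≥ 0. Then for every x ≥ 0, with g(θ,q,x,a) := W_r(x+a) − q·∫_0^x W_θ(x−z)·W_r(z+a) dz, one has lim_{a→∞} g(θ,q,x,a)/W_r(a) = e^{β x}·(1 − q·∫_0^x e^{−β z} W_θ(z) dz). -/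
open MeasureTheory Set Real Filter

/-- For `x ≥ 0`, `lim_{a→∞} g(θ,q,x,a)/W_r(a) = e^{βx}(1 − q∫_0^x e^{−βz}W_θ(z)dz)`,
where `g(θ,q,x,a) = W_r(x+a) − q∫_0^x W_θ(x−z)W_r(z+a)dz`; the limit is the
auxiliary function `𝓗^{(θ+q,−q)}(x)` of the paper. -/
theorem g_over_Wr_tendsto (θ q β : ℝ) (hθ : 0 ≤ θ) (hq : 0 < q) (hβ : 0 ≤ β)
    (Wθ Wr : ℝ → ℝ)
    (hWθ0 : ∀ z < (0 : ℝ), Wθ z = 0) (hWr0 : ∀ z < (0 : ℝ), Wr z = 0)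
    (hWθc : ContinuousOn Wθ (Ici 0)) (hWrc : ContinuousOn Wr (Ici 0))
    (hconv : ∀ s ≥ (0 : ℝ),
      q * ∫ z in (0 : ℝ)..s, Wθ (s - z) * Wr z = Wr s - Wθ s)
    (hmono : MonotoneOn Wr (Ioi 0)) (hpos : ∀ a > (0 : ℝ), 0 < Wr a)
    (hshift : ∀ s : ℝ,
      Tendsto (fun a => Wr (a + s) / Wr a) atTop (nhds (Real.exp (β * s)))) :
    ∀ x ≥ (0 : ℝ),
      Tendsto
        (fun a => (Wr (x + a) - q * ∫ z in (0 : ℝ)..x, Wθ (x - z) * Wr (z + a)) / Wr a)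
        atTop
        (nhds (Real.exp (β * x) * (1 - q * ∫ z in (0 : ℝ)..x, Real.exp (-β * z) * Wθ z))) := by
  intro x hx
  have hθcont : ContinuousOn (fun z => Wθ (x - z)) (Icc 0 x) :=
    hWθc.comp (by fun_prop) fun z hz => sub_nonneg.2 hz.2
  have hlim : Tendsto (fun a => ∫ z in (0 : ℝ)..x, Wθ (x - z) * (Wr (z + a) / Wr a)) atTop
      (nhds (∫ z in (0 : ℝ)..x, Wθ (x - z) * Real.exp (β * z))) := by
    refine intervalIntegral.tendsto_integral_filter_of_dominated_convergence
      (fun z => |Wθ (x - z)| * (Real.exp (β * x) + 1)) ?_ ?_ ?_ ?_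
    · filter_upwards [eventually_gt_atTop 0] with a ha
      rw [uIoc_of_le hx]
      have hrcont : ContinuousOn (fun z => Wr (z + a)) (Icc 0 x) :=
        hWrc.comp (by fun_prop) fun z hz => add_nonneg hz.1 ha.le
      exact ((hθcont.mul (hrcont.div_const _)).mono Ioc_subset_Icc_self).aestronglyMeasurable
        measurableSet_Ioc
    · filter_upwards [eventually_gt_atTop 0,
        (hshift x).eventually (eventually_le_nhds (lt_add_one _))] with a ha hbound
      refine Eventually.of_forall fun z hz => ?_
      rw [uIoc_of_le hx] at hz
      have hza : 0 < z + a := add_pos hz.1 ha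
      rw [norm_mul, Real.norm_eq_abs, Real.norm_of_nonneg (div_pos (hpos _ hza) (hpos _ ha)).le]
      refine mul_le_mul_of_nonneg_left (le_trans ?_ hbound) (abs_nonneg _)
      refine div_le_div_of_nonneg_right ?_ (hpos _ ha).le
      exact hmono hza (add_pos_of_pos_of_nonneg ha hx) (by linarith [hz.2])
    · refine ContinuousOn.intervalIntegrable ?_
      rw [uIcc_of_le hx]
      exact hθcont.abs.mul_const _
    · refine Eventually.of_forall fun z _ => ?_
      simpa only [add_comm] using (hshift z).const_mul (Wθ (x - z))
  have hsubst : ∫ z in (0 : ℝ)..x, Wθ (x - z) * Real.exp (β * z) =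
      Real.exp (β * x) * ∫ z in (0 : ℝ)..x, Real.exp (-β * z) * Wθ z := by
    have h := intervalIntegral.integral_comp_sub_left (a := 0) (b := x)
      (fun z => Real.exp (β * x) * (Real.exp (-β * z) * Wθ z)) x
    rw [sub_self, sub_zero] at h
    rw [← intervalIntegral.integral_const_mul, ← h]
    congr 1
    ext z
    rw [← mul_assoc, ← Real.exp_add, mul_comm]
    congr 2
    ring
  have h := (hshift x).sub (hlim.const_mul q)
  rw [hsubst] at h
  convert h using 2 with a
  · simp only [← mul_div_assoc, intervalIntegral.integral_div, sub_div, add_comm]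
  · ring
end
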